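/- Let k be an algebraic closure of F₂, set a₄ = c⁶ + c⁵ + c⁴ + c² + 1 and a₂ = c⁹ + c⁸ + c⁷ + c⁶ + c⁴ + c² + 1. Then the polynomial f = x¹² + c²x¹⁰ + c·a₄·x⁸ + c³(c⁶ + c + 1)x⁶ + c²·a₂·x⁴ + c⁶x² + c⁸(c+1)² is irreducible in the two-variable polynomial ring k[x,c]. -/

import Mathlib

open MvPolynomial

noncomputable section

/-- The polynomial
`f = x¹² + c²x¹⁰ + c·a₄·x⁸ + c³(c⁶+c+1)x⁶ + c²·a₂·x⁴ + c⁶x² + c⁸(c+1)²` over the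
algebraic closure of `𝔽₂`, where `a₄ = c⁶+c⁵+c⁴+c²+1`, `a₂ = c⁹+c⁸+c⁷+c⁶+c⁴+c²+1`,
and `x = X 0`, `c = X 1`. -/
def fPoly : MvPolynomial (Fin 2) (AlgebraicClosure (ZMod 2)) :=
  let x : MvPolynomial (Fin 2) (AlgebraicClosure (ZMod 2)) := X 0
  let c : MvPolynomial (Fin 2) (AlgebraicClosure (ZMod 2)) := X 1
  x ^ 12 + c ^ 2 * x ^ 10 + c * (c ^ 6 + c ^ 5 + c ^ 4 + c ^ 2 + 1) * x ^ 8
    + c ^ 3 * (c ^ 6 + c + 1) * x ^ 6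
    + c ^ 2 * (c ^ 9 + c ^ 8 + c ^ 7 + c ^ 6 + c ^ 4 + c ^ 2 + 1) * x ^ 4
    + c ^ 6 * x ^ 2 + c ^ 8 * (c + 1) ^ 2

/-- Weighted orders are superadditive the right way round: lower bounds for the weights of the
monomials of a product split as a sum of lower bounds for the two factors. -/
theorem weight_split {k : Type*} [Field k] (A B : MvPolynomial (Fin 2) k) (hA : A ≠ 0)
    (hB : B ≠ 0) (u v n : ℤ)
    (h : ∀ m, coeff m (A * B) ≠ 0 → n ≤ u * (m 0 : ℤ) + v * (m 1 : ℤ)) :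
    ∃ a b : ℤ, n ≤ a + b ∧ (∀ m, coeff m A ≠ 0 → a ≤ u * (m 0 : ℤ) + v * (m 1 : ℤ)) ∧
      (∀ m, coeff m B ≠ 0 → b ≤ u * (m 0 : ℤ) + v * (m 1 : ℤ)) := by
  classical
  let W : (Fin 2 →₀ ℕ) → ℤ := fun m => u * (m 0 : ℤ) + v * (m 1 : ℤ)
  have hW : ∀ m m', W (m + m') = W m + W m' := by
    intro m m'
    simp only [W, Finsupp.add_apply]
    push_cast
    ring
  have key : ∀ P : MvPolynomial (Fin 2) k, P ≠ 0 → ∃ P0 : MvPolynomial (Fin 2) k, ∃ a : ℤ,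
      P0 ≠ 0 ∧ (∀ m, coeff m P ≠ 0 → a ≤ W m) ∧
      ∀ m, coeff m P0 = if W m = a then coeff m P else 0 := by
    intro P hP
    have hne : P.support.Nonempty := by
      rwa [Finset.nonempty_iff_ne_empty, Ne, MvPolynomial.support_eq_empty]
    obtain ⟨m0, hm0, hmin⟩ := P.support.exists_min_image W hne
    have hco : ∀ m, coeff m (∑ d ∈ P.support with W d = W m0, monomial d (coeff d P)) =
        if W m = W m0 then coeff m P else 0 := by
      intro m
      rw [coeff_sum]
      simp only [coeff_monomial, Finset.sum_ite_eq', Finset.mem_filter, mem_support_iff]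
      by_cases h1 : W m = W m0 <;> by_cases h2 : coeff m P = 0 <;> simp [h1, h2]
    refine ⟨_, W m0, ?_, ?_, hco⟩
    · intro h0
      have := hco m0
      rw [h0] at this
      simp at this
      exact (mem_support_iff.1 hm0) this.symm
    · intro m hm
      exact hmin m (mem_support_iff.2 hm)
  obtain ⟨A0, a, hA0, hAa, hcA⟩ := key A hA
  obtain ⟨B0, b, hB0, hBb, hcB⟩ := key B hB
  refine ⟨a, b, ?_, hAa, hBb⟩
  obtain ⟨m, hm⟩ := MvPolynomial.ne_zero_iff.1 (mul_ne_zero hA0 hB0)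
  have hwm : W m = a + b := by
    rw [coeff_mul] at hm
    obtain ⟨p, hp, hne⟩ := Finset.exists_ne_zero_of_sum_ne_zero hm
    rw [Finset.HasAntidiagonal.mem_antidiagonal] at hp
    rw [hcA, hcB] at hne
    rw [← hp, hW]
    split_ifs at hne with h1 h2 <;> simp_all
  have heq : coeff m (A * B) = coeff m (A0 * B0) := by
    rw [coeff_mul, coeff_mul]
    refine Finset.sum_congr rfl ?_
    intro p hp
    rw [Finset.HasAntidiagonal.mem_antidiagonal] at hp
    have hs : W p.1 + W p.2 = a + b := by rw [← hW, hp, hwm]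
    rw [hcA, hcB]
    by_cases h1 : coeff p.1 A = 0
    · simp [h1]
    by_cases h2 : coeff p.2 B = 0
    · simp [h2]
    have h3 := hAa _ h1
    have h4 := hBb _ h2
    rw [if_pos (by omega), if_pos (by omega)]
  rw [← hwm]
  exact h m (by rw [heq]; exact hm)

/-- The exponent vector `(i, j)`. -/
def ex (i j : ℕ) : Fin 2 →₀ ℕ := Finsupp.single 0 i + Finsupp.single 1 j

theorem ex_zero (i j : ℕ) : ex i j 0 = i := by simp [ex]

theorem ex_one (i j : ℕ) : ex i j 1 = j := by simp [ex]

theorem eq_ex (m : Fin 2 →₀ ℕ) (i j : ℕ) (h0 : m 0 = i) (h1 : m 1 = j) : m = ex i j := by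
  ext t
  fin_cases t
  · simpa [ex_zero] using h0
  · simpa [ex_one] using h1

theorem ex_eq_iff (i j : ℕ) (m : Fin 2 →₀ ℕ) : ex i j = m ↔ (m 0 = i ∧ m 1 = j) := by
  constructor
  · rintro rfl
    exact ⟨ex_zero i j, ex_one i j⟩
  · rintro ⟨h0, h1⟩
    exact (eq_ex m i j h0 h1).symm

theorem split_mem {k : Type*} [Field k] (A B : MvPolynomial (Fin 2) k) (i j : ℕ)
    (h : coeff (ex i j) (A * B) ≠ 0) :
    ∃ m m', coeff m A ≠ 0 ∧ coeff m' B ≠ 0 ∧ m 0 + m' 0 = i ∧ m 1 + m' 1 = j := by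
  classical
  rw [coeff_mul] at h
  obtain ⟨p, hp, hne⟩ := Finset.exists_ne_zero_of_sum_ne_zero h
  rw [Finset.HasAntidiagonal.mem_antidiagonal] at hp
  refine ⟨p.1, p.2, left_ne_zero_of_mul hne, right_ne_zero_of_mul hne, ?_, ?_⟩
  · rw [← Finsupp.add_apply, hp, ex_zero]
  · rw [← Finsupp.add_apply, hp, ex_one]

theorem mono_eq (i j : ℕ) : (X 0 ^ i * X 1 ^ j : MvPolynomial (Fin 2) (AlgebraicClosure (ZMod 2)))
    = monomial (ex i j) 1 := by
  rw [X_pow_eq_monomial, X_pow_eq_monomial, monomial_mul, ex, one_mul]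

theorem two_zero : (2 : MvPolynomial (Fin 2) (AlgebraicClosure (ZMod 2))) = 0 := by
  have : ((2 : ℕ) : MvPolynomial (Fin 2) (AlgebraicClosure (ZMod 2))) = 0 :=
    CharP.cast_eq_zero _ 2
  exact_mod_cast this

/-- The exponents of `f`. -/
def S : List (ℕ × ℕ) :=
  [(12, 0), (10, 2), (8, 7), (8, 6), (8, 5), (8, 3), (8, 1), (6, 9), (6, 4), (6, 3),
   (4, 11), (4, 10), (4, 9), (4, 8), (4, 6), (4, 4), (4, 2), (2, 6), (0, 10), (0, 8)]

theorem fPoly_eq : fPoly = (S.map fun p => monomial (ex p.1 p.2) 1).sum := by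
  simp only [S, List.map_cons, List.map_nil, List.sum_cons, List.sum_nil, ← mono_eq, fPoly]
  linear_combination (X 1 ^ 9 : MvPolynomial (Fin 2) (AlgebraicClosure (ZMod 2))) * two_zero

theorem coeff_fPoly (m : Fin 2 →₀ ℕ) :
    coeff m fPoly = if (m 0, m 1) ∈ S then 1 else 0 := by
  classical
  rw [fPoly_eq]
  simp only [S, List.map_cons, List.map_nil, List.sum_cons, List.sum_nil, coeff_add,
    coeff_monomial, ex_eq_iff, coeff_zero]
  generalize m 0 = i
  generalize m 1 = j
  by_cases h : (i, j) ∈ S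
  · rw [S] at h
    simp only [List.mem_cons, List.not_mem_nil, Prod.mk.injEq, or_false] at h
    rcases h with h | h | h | h | h | h | h | h | h | h | h | h | h | h | h | h | h | h | h | h <;>
    · obtain ⟨rfl, rfl⟩ := h
      simp
  · rw [S] at h
    simp only [List.mem_cons, List.not_mem_nil, Prod.mk.injEq, or_false, not_or] at h
    simp [h]

theorem supp_fPoly (m : Fin 2 →₀ ℕ) (h : coeff m fPoly ≠ 0) :
    -84 ≤ (-7) * (m 0 : ℤ) + (-4) * (m 1 : ℤ) ∧ -15 ≤ (-1) * (m 0 : ℤ) + (-1) * (m 1 : ℤ) ∧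
    -40 ≤ 1 * (m 0 : ℤ) + (-4) * (m 1 : ℤ) ∧ 0 ≤ 1 * (m 0 : ℤ) + 0 * (m 1 : ℤ) ∧
    16 ≤ 3 * (m 0 : ℤ) + 2 * (m 1 : ℤ) ∧ 12 ≤ 1 * (m 0 : ℤ) + 4 * (m 1 : ℤ) := by
  rw [coeff_fPoly] at h
  have h : (m 0, m 1) ∈ S := by
    by_contra h'
    simp [h'] at h
  generalize m 0 = i at *
  generalize m 1 = j at *
  have : ∀ p ∈ S, -84 ≤ (-7) * (p.1 : ℤ) + (-4) * (p.2 : ℤ) ∧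
    -15 ≤ (-1) * (p.1 : ℤ) + (-1) * (p.2 : ℤ) ∧
    -40 ≤ 1 * (p.1 : ℤ) + (-4) * (p.2 : ℤ) ∧ 0 ≤ 1 * (p.1 : ℤ) + 0 * (p.2 : ℤ) ∧
    16 ≤ 3 * (p.1 : ℤ) + 2 * (p.2 : ℤ) ∧ 12 ≤ 1 * (p.1 : ℤ) + 4 * (p.2 : ℤ) := by decide
  exact this _ h

theorem coeff_ne (i j : ℕ) (h : (i, j) ∈ S) : coeff (ex i j) fPoly ≠ 0 := by
  rw [coeff_fPoly, ex_zero, ex_one, if_pos h]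
  exact one_ne_zero

/-- The exceptional polygon decomposition is excluded by comparing the coefficients of
`x² c⁶` and `x² c⁵`. -/
theorem no_exceptional (A B : MvPolynomial (Fin 2) (AlgebraicClosure (ZMod 2)))
    (hAB : A * B = fPoly)
    (ha : ∀ m, coeff m A ≠ 0 → 8 ≤ (m 0 : ℤ) + 4 * (m 1 : ℤ))
    (hb : ∀ m, coeff m B ≠ 0 → 12 ≤ 3 * (m 0 : ℤ) + 2 * (m 1 : ℤ))
    (hb' : ∀ m, coeff m B ≠ 0 → -28 ≤ (-7) * (m 0 : ℤ) + (-4) * (m 1 : ℤ))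
    (h02 : coeff (ex 0 2) A ≠ 0) : False := by
  classical
  obtain ⟨m, m', h1, h2, h3, h4⟩ := split_mem A B 2 6 (by rw [hAB]; exact coeff_ne _ _ (by decide))
  have i1 := ha _ h1
  have i2 := hb _ h2
  have i3 := hb' _ h2
  have i4 : m' 0 = 0 ∨ m' 0 = 1 ∨ m' 0 = 2 := by omega
  have e : m' = ex 2 3 := eq_ex _ _ _ (by omega) (by rcases i4 with h | h | h <;> omega)
  rw [e] at h2
  have hz : coeff (ex 2 5) (A * B) = 0 := by
    rw [hAB, coeff_fPoly, ex_zero, ex_one, if_neg (by decide)]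
  rw [coeff_mul, Finset.sum_eq_single (ex 0 2, ex 2 3)] at hz
  · exact mul_ne_zero h02 h2 hz
  · intro p hp hpne
    rw [Finset.HasAntidiagonal.mem_antidiagonal] at hp
    by_contra hne
    have j1 := ha _ (left_ne_zero_of_mul hne)
    have j2 := hb _ (right_ne_zero_of_mul hne)
    have k0 : p.1 0 + p.2 0 = 2 := by rw [← Finsupp.add_apply, hp, ex_zero]
    have k1 : p.1 1 + p.2 1 = 5 := by rw [← Finsupp.add_apply, hp, ex_one]
    exact hpne (Prod.ext (eq_ex _ _ _ (by omega) (by omega)) (eq_ex _ _ _ (by omega) (by omega)))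
  · intro hn
    exfalso
    apply hn
    rw [Finset.HasAntidiagonal.mem_antidiagonal]
    exact eq_ex _ _ _ (by simp [ex_zero]) (by simp [ex_one])

theorem isUnit_of_supp (A : MvPolynomial (Fin 2) (AlgebraicClosure (ZMod 2))) (hA : A ≠ 0)
    (h : ∀ m, coeff m A ≠ 0 → m 0 = 0 ∧ m 1 = 0) : IsUnit A := by
  classical
  have hm : ∀ m, coeff m A ≠ 0 → m = 0 := by
    intro m hm
    obtain ⟨h0, h1⟩ := h m hm
    ext t
    fin_cases t
    · simpa using h0
    · simpa using h1
  have hC : A = C (coeff 0 A) := by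
    ext m
    rw [coeff_C]
    split_ifs with h'
    · rw [h']
    · by_contra hne
      exact h' (hm m hne).symm
  have h0 : coeff 0 A ≠ 0 := by
    intro h0
    rw [h0, C_0] at hC
    exact hA hC
  rw [hC]
  exact (isUnit_iff_ne_zero.2 h0).map C

/-- The lattice polygon bookkeeping: the possible Minkowski summands. -/
theorem polygon_cases (x1 x2 y2 x3 y3 y4 y5 x6 y6 : ℕ)
    (e1 : 7 * (x1 : ℤ) = 7 * x2 + 4 * y2) (e2 : (x2 : ℤ) + y2 = x3 + y3)
    (e3 : (x3 : ℤ) + 4 * y4 = 4 * y3) (e5 : 2 * (y5 : ℤ) = 3 * x6 + 2 * y6)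
    (e6 : (x1 : ℤ) = x6 + 4 * y6) (s45 : y5 ≤ y4 ∧ y4 ≤ y5 + 2) (s23 : x3 ≤ x2 ∧ x2 ≤ x3 + 4)
    (c2 : y2 = 0 ∨ y2 = 7) (c3 : x3 = 0 ∨ x3 = 4) (c6 : y6 = 0 ∨ y6 = 1 ∨ y6 = 2)
    (c6' : x6 = 0 ∨ x6 = 2 ∨ x6 = 4) :
    x1 = 0 ∨ x1 = 12 ∨ (x1 = 8 ∧ y5 = 2) ∨ (x1 = 4 ∧ y5 = 6) := by
  obtain ⟨s, s'⟩ := s45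
  obtain ⟨t, t'⟩ := s23
  have hy5 : (y5 : ℤ) = x6 + x6 / 2 + y6 := by omega
  rcases c2 with rfl | rfl <;> rcases c3 with rfl | rfl <;> rcases c6 with rfl | rfl | rfl <;>
    rcases c6' with rfl | rfl | rfl <;> norm_num at * <;> omega

/-- `f` is irreducible in `k[x,c]` where `k` is an algebraic closure of `𝔽₂`. -/
theorem fPoly_irreducible : Irreducible fPoly := by
  have hf0 : fPoly ≠ 0 := by
    intro h
    apply coeff_ne 12 0 (by decide)
    rw [h, coeff_zero]
  constructor
  · intro hu
    obtain ⟨g, hg⟩ := isUnit_iff_exists_inv.1 hu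
    have hg0 : g ≠ 0 := right_ne_zero_of_mul (hg ▸ one_ne_zero)
    obtain ⟨a, b, hab, ha, hb⟩ := weight_split fPoly g hf0 hg0 0 (-1) 0 (by
      intro m hm
      rw [hg, coeff_one] at hm
      have : m = 0 := by
        by_contra h'
        exact hm (if_neg (Ne.symm h'))
      simp [this])
    have h1 := ha _ (coeff_ne 4 11 (by decide))
    rw [ex_zero, ex_one] at h1
    obtain ⟨m, hm⟩ := MvPolynomial.ne_zero_iff.1 hg0
    have h2 := hb _ hm
    omega
  · intro A B hAB
    have hA : A ≠ 0 := left_ne_zero_of_mul (hAB ▸ hf0)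
    have hB : B ≠ 0 := right_ne_zero_of_mul (hAB ▸ hf0)
    have hs : ∀ m, coeff m (A * B) ≠ 0 → _ := fun m hm => supp_fPoly m (hAB ▸ hm)
    obtain ⟨a1, b1, n1, ha1, hb1⟩ := weight_split A B hA hB _ _ _ fun m hm => (hs m hm).1
    obtain ⟨a2, b2, n2, ha2, hb2⟩ := weight_split A B hA hB _ _ _ fun m hm => (hs m hm).2.1
    obtain ⟨a3, b3, n3, ha3, hb3⟩ := weight_split A B hA hB _ _ _ fun m hm => (hs m hm).2.2.1
    obtain ⟨a4, b4, n4, ha4, hb4⟩ := weight_split A B hA hB _ _ _ fun m hm => (hs m hm).2.2.2.1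
    obtain ⟨a5, b5, n5, ha5, hb5⟩ := weight_split A B hA hB _ _ _ fun m hm => (hs m hm).2.2.2.2.1
    obtain ⟨a6, b6, n6, ha6, hb6⟩ := weight_split A B hA hB _ _ _ fun m hm => (hs m hm).2.2.2.2.2
    have hc : ∀ i j, (i, j) ∈ S → coeff (ex i j) (A * B) ≠ 0 := fun i j h => hAB ▸ coeff_ne i j h
    obtain ⟨p1, q1, hp1, hq1, x1, y1⟩ := split_mem A B _ _ (hc 12 0 (by decide))
    obtain ⟨p2, q2, hp2, hq2, x2, y2⟩ := split_mem A B _ _ (hc 8 7 (by decide))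
    obtain ⟨p3, q3, hp3, hq3, x3, y3⟩ := split_mem A B _ _ (hc 4 11 (by decide))
    obtain ⟨p4, q4, hp4, hq4, x4, y4⟩ := split_mem A B _ _ (hc 0 10 (by decide))
    obtain ⟨p5, q5, hp5, hq5, x5, y5⟩ := split_mem A B _ _ (hc 0 8 (by decide))
    obtain ⟨p6, q6, hp6, hq6, x6, y6⟩ := split_mem A B _ _ (hc 4 2 (by decide))
    have A11 := ha1 _ hp1
    have A12 := ha1 _ hp2
    have A22 := ha2 _ hp2
    have A23 := ha2 _ hp3
    have A33 := ha3 _ hp3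
    have A34 := ha3 _ hp4
    have A44 := ha4 _ hp4
    have A45 := ha4 _ hp5
    have A55 := ha5 _ hp5
    have A56 := ha5 _ hp6
    have A66 := ha6 _ hp6
    have A61 := ha6 _ hp1
    have B11 := hb1 _ hq1
    have B12 := hb1 _ hq2
    have B22 := hb2 _ hq2
    have B23 := hb2 _ hq3
    have B33 := hb3 _ hq3
    have B34 := hb3 _ hq4
    have B44 := hb4 _ hq4
    have B45 := hb4 _ hq5
    have B55 := hb5 _ hq5
    have B56 := hb5 _ hq6
    have B66 := hb6 _ hq6
    have B61 := hb6 _ hq1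
    have A14 := ha1 _ hp4
    have B14 := hb1 _ hq4
    have A41 := ha4 _ hp1
    have B41 := hb4 _ hq1
    have A24 := ha2 _ hp4
    have B24 := hb2 _ hq4
    have A35 := ha3 _ hp5
    have B35 := hb3 _ hq5
    have A21 := ha2 _ hp1
    have B21 := hb2 _ hq1
    have A32 := ha3 _ hp2
    have B32 := hb3 _ hq2
    have A54 := ha5 _ hp4
    have B54 := hb5 _ hq4
    have A65 := ha6 _ hp5
    have B65 := hb6 _ hq5
    -- the four possible shapes of the polygon of `A`
    have main : (a1 = 0 ∧ a6 = 0 ∧ a4 = 0) ∨ (b1 = 0 ∧ b6 = 0 ∧ b4 = 0) ∨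
        (a6 = 8 ∧ b5 = 12 ∧ b1 = -28 ∧ p5 0 = 0 ∧ p5 1 = 2) ∨
        (b6 = 8 ∧ a5 = 12 ∧ a1 = -28 ∧ q5 0 = 0 ∧ q5 1 = 2) := by
      have z1 : p1 1 = 0 := by omega
      have z4 : p4 0 = 0 := by omega
      have z5 : p5 0 = 0 := by omega
      have e1 : 7 * (p1 0 : ℤ) = 7 * p2 0 + 4 * p2 1 := by omega
      have e2 : (p2 0 : ℤ) + p2 1 = p3 0 + p3 1 := by omega
      have e3 : (p3 0 : ℤ) + 4 * p4 1 = 4 * p3 1 := by omega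
      have e5 : 2 * (p5 1 : ℤ) = 3 * p6 0 + 2 * p6 1 := by omega
      have e6 : (p1 0 : ℤ) = p6 0 + 4 * p6 1 := by omega
      have s45 : p5 1 ≤ p4 1 ∧ p4 1 ≤ p5 1 + 2 := by omega
      have s23 : p3 0 ≤ p2 0 ∧ p2 0 ≤ p3 0 + 4 := by omega
      have c2 : p2 1 = 0 ∨ p2 1 = 7 := by omega
      have c3 : p3 0 = 0 ∨ p3 0 = 4 := by omega
      have c6 : p6 1 = 0 ∨ p6 1 = 1 ∨ p6 1 = 2 := by omega
      have c6' : p6 0 = 0 ∨ p6 0 = 2 ∨ p6 0 = 4 := by omega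
      have w1 : a1 = -7 * (p1 0 : ℤ) ∧ b1 = -84 - a1 := by omega
      have w4 : a4 = 0 ∧ b4 = 0 := by omega
      have w5 : a5 = 2 * (p5 1 : ℤ) ∧ b5 = 16 - a5 := by omega
      have w6 : a6 = (p1 0 : ℤ) ∧ b6 = 12 - a6 := by omega
      have key := polygon_cases _ _ _ _ _ _ _ _ _ e1 e2 e3 e5 e6 s45 s23 c2 c3 c6 c6'
      clear A11 A12 A22 A23 A33 A34 A44 A45 A55 A56 A66 A61 B11 B12 B22 B23 B33 B34 B44 B45 B55
      clear B56 B66 B61 A14 B14 A41 B41 A24 B24 A35 B35 A21 B21 A32 B32 A54 B54 A65 B65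
      clear c2 c3 c6 c6' e1 e2 e3 e5 e6 s45 s23
      rcases key with k | k | k | k
      · left
        omega
      · right; left
        omega
      · right; right; left
        omega
      · right; right; right
        omega
    rcases main with h | h | h | h
    · left
      refine isUnit_of_supp A hA fun m hm => ?_
      have := ha1 m hm
      omega
    · right
      refine isUnit_of_supp B hB fun m hm => ?_
      have := hb1 m hm
      omega
    · exfalso
      obtain ⟨h6, h5, h1, hx, hy⟩ := h
      refine no_exceptional A B hAB.symm (fun m hm => ?_) (fun m hm => ?_)
        (fun m hm => ?_) ?_
      · have := ha6 m hm
        omega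
      · have := hb5 m hm
        omega
      · have := hb1 m hm
        omega
      · rw [← eq_ex p5 0 2 hx hy]
        exact hp5
    · exfalso
      obtain ⟨h6, h5, h1, hx, hy⟩ := h
      refine no_exceptional B A (by rw [mul_comm, ← hAB]) (fun m hm => ?_) (fun m hm => ?_)
        (fun m hm => ?_) ?_
      · have := hb6 m hm
        omega
      · have := ha5 m hm
        omega
      · have := ha1 m hm
        omega
      · rw [← eq_ex q5 0 2 hx hy]
        exact hq5

end
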